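/- Let N ≥ 2. There exists a constant C = C(N) ≥ 1 such that for every nonnegative bounded Radon measure μ on ℝ^{N+1}: C^{−1} ∫_{ℝ^{N+1}} ∫_0^1 ( μ(Q̃_r(x,t)) )^{2/N} (dr/r) dμ(x,t) ≤ ∫_{ℝ^{N+1}} ( I_2^1[μ](x,t) )^{(N+2)/N} dx dt ≤ C ∫_{ℝ^{N+1}} ∫_0^1 ( μ(Q̃_r(x,t)) )^{2/N} (dr/r) dμ(x,t), where the middle integral is with respect to Lebesgue measure on ℝ^{N+1}. -/

import Mathlib

open MeasureTheory Metric Set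
open scoped ENNReal NNReal

noncomputable section

/-- Points of `ℝ^{N+1}` are written `(x, t)` with `x ∈ ℝ^N` and `t ∈ ℝ`. -/
abbrev PSpace (N : ℕ) := EuclideanSpace ℝ (Fin N) × ℝ

/-- The parabolic cylinder `Q_δ(x,t) = B_δ(x) × (t - δ², t]`. -/
def pQ (N : ℕ) (δ : ℝ) (z : PSpace N) : Set (PSpace N) :=
  ball z.1 δ ×ˢ Ioc (z.2 - δ ^ 2) z.2

/-- The parabolic cylinder `Q̃_r(x,t) = B_r(x) × (t - r², t + r²)`. -/
def pQt (N : ℕ) (r : ℝ) (z : PSpace N) : Set (PSpace N) :=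
  ball z.1 r ×ˢ Ioo (z.2 - r ^ 2) (z.2 + r ^ 2)

/-- The parabolic boundary of an open set `O ⊆ ℝ^{N+1}`: points of the topological
boundary such that every downward cylinder `Q_δ` meets the complement of `O`. -/
def pBoundary (N : ℕ) (O : Set (PSpace N)) : Set (PSpace N) :=
  {z ∈ frontier O | ∀ δ > 0, (pQ N δ z ∩ Oᶜ).Nonempty}

/-- Partial derivative in time. -/
def tDeriv {N : ℕ} (u : PSpace N → ℝ) (z : PSpace N) : ℝ :=
  deriv (fun s => u (z.1, s)) z.2

/-- Partial derivative in the `i`-th spatial direction. -/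
def xDeriv {N : ℕ} (i : Fin N) (u : PSpace N → ℝ) (z : PSpace N) : ℝ :=
  lineDeriv ℝ (fun y => u (y, z.2)) z.1 (EuclideanSpace.single i 1)

/-- Second spatial partial derivative. -/
def xxDeriv {N : ℕ} (i j : Fin N) (u : PSpace N → ℝ) (z : PSpace N) : ℝ :=
  xDeriv i (xDeriv j u) z

/-- Spatial Laplacian. -/
def lapl {N : ℕ} (u : PSpace N → ℝ) (z : PSpace N) : ℝ :=
  ∑ i : Fin N, xxDeriv i i u z

/-- Euclidean norm of the spatial gradient. -/
def gradNorm {N : ℕ} (u : PSpace N → ℝ) (z : PSpace N) : ℝ :=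
  Real.sqrt (∑ i : Fin N, (xDeriv i u z) ^ 2)

/-- `u ∈ C^{2,1}(O)` : `u`, its first and second spatial derivatives and its time
derivative exist and are continuous in `O`. -/
structure IsC21 {N : ℕ} (O : Set (PSpace N)) (u : PSpace N → ℝ) : Prop where
  cont : ContinuousOn u O
  diff_t : ∀ z ∈ O, DifferentiableAt ℝ (fun s => u (z.1, s)) z.2
  cont_t : ContinuousOn (tDeriv u) O
  diff_x : ∀ (i : Fin N), ∀ z ∈ O,
    LineDifferentiableAt ℝ (fun y => u (y, z.2)) z.1 (EuclideanSpace.single i 1)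
  cont_x : ∀ i : Fin N, ContinuousOn (xDeriv i u) O
  diff_xx : ∀ (i j : Fin N), ∀ z ∈ O,
    LineDifferentiableAt ℝ (fun y => xDeriv j u (y, z.2)) z.1 (EuclideanSpace.single i 1)
  cont_xx : ∀ i j : Fin N, ContinuousOn (xxDeriv i j u) O

/-- The blow-up condition `lim_{δ→0} inf_{O ∩ Q_δ(z)} u = ∞` at every point of the
parabolic boundary. -/
def BlowsUp {N : ℕ} (O : Set (PSpace N)) (u : PSpace N → ℝ) : Prop :=
  ∀ z ∈ pBoundary N O, ∀ M : ℝ, ∃ δ > (0 : ℝ), ∀ w ∈ O ∩ pQ N δ z, M ≤ u w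

/-- A large solution of `∂_t u - Δu + f(u) = 0` in `O`. -/
def IsLargeSolution {N : ℕ} (O : Set (PSpace N)) (f : ℝ → ℝ) (u : PSpace N → ℝ) : Prop :=
  IsC21 O u ∧ (∀ z ∈ O, tDeriv u z - lapl u z + f (u z) = 0) ∧ BlowsUp O u

/-- The parabolic Sobolev norm `‖φ‖_{W^{2,1}_p(ℝ^{N+1})}`. -/
def W21Norm (N : ℕ) (p : ℝ) (φ : PSpace N → ℝ) : ℝ :=
  (eLpNorm φ (ENNReal.ofReal p) volume).toReal
    + (eLpNorm (tDeriv φ) (ENNReal.ofReal p) volume).toReal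
    + (eLpNorm (gradNorm φ) (ENNReal.ofReal p) volume).toReal
    + ∑ i : Fin N, ∑ j : Fin N, (eLpNorm (xxDeriv i j φ) (ENNReal.ofReal p) volume).toReal

/-- The capacity `Cap_{2,1,p}` of a compact set `K ⊆ ℝ^{N+1}`. -/
def cap21c (N : ℕ) (p : ℝ) (K : Set (PSpace N)) : ℝ :=
  sInf { c | ∃ φ : SchwartzMap (PSpace N) ℝ,
    (∃ U, IsOpen U ∧ K ⊆ U ∧ ∀ z ∈ U, 1 ≤ φ z) ∧ c = W21Norm N p (fun z => φ z) ^ p }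

/-- The capacity `Cap_{2,1,p}` of an arbitrary (Suslin) set. -/
def cap21 (N : ℕ) (p : ℝ) (E : Set (PSpace N)) : ℝ :=
  sSup { c | ∃ D, D ⊆ E ∧ IsCompact D ∧ c = cap21c N p D }

/-- The parabolic Hausdorff capacity `PH_ρ^N(E)`. -/
def PHcap (N : ℕ) (ρ : ℝ) (E : Set (PSpace N)) : ℝ≥0∞ :=
  ⨅ (c : ℕ → PSpace N × ℝ)
    (_ : (∀ j, 0 ≤ (c j).2 ∧ (c j).2 ≤ ρ) ∧ E ⊆ ⋃ j, pQt N (c j).2 (c j).1),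
    ∑' j, ENNReal.ofReal ((c j).2 ^ N)

/-- The truncated Riesz parabolic potential `I_2^R[μ]`. -/
def riesz (N : ℕ) (R : ℝ) (μ : Measure (PSpace N)) (z : PSpace N) : ℝ≥0∞ :=
  ∫⁻ ρ in Ioo (0 : ℝ) R, μ (pQt N ρ z) / ENNReal.ofReal (ρ ^ (N + 1))

/-- The truncated fractional maximal parabolic potential `M_2^R[μ]`. -/
def maxPot (N : ℕ) (R : ℝ) (μ : Measure (PSpace N)) (z : PSpace N) : ℝ≥0∞ :=
  ⨆ (ρ : ℝ) (_ : ρ ∈ Ioo (0 : ℝ) R), μ (pQt N ρ z) / ENNReal.ofReal (ρ ^ N)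

/-- The Gaussian heat kernel on `ℝ^{N+1}`. -/
def heatK (N : ℕ) (z : PSpace N) : ℝ :=
  if 0 < z.2 then (4 * Real.pi * z.2) ^ (-(N : ℝ) / 2) * Real.exp (-‖z.1‖ ^ 2 / (4 * z.2))
  else 0

/-- The heat potential `(ℍ * μ)(x,t)` of a nonnegative measure. -/
def heatPot (N : ℕ) (μ : Measure (PSpace N)) (z : PSpace N) : ℝ≥0∞ :=
  ∫⁻ w, ENNReal.ofReal (heatK N (z.1 - w.1, z.2 - w.2)) ∂μ

/-- Exponential on `ℝ≥0∞`. -/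
def expE (x : ℝ≥0∞) : ℝ≥0∞ := if x = ⊤ then ⊤ else ENNReal.ofReal (Real.exp x.toReal)

/-- Parabolic distance from a point to a set (taken over points at earlier times). -/
def pDist (N : ℕ) (z : PSpace N) (S : Set (PSpace N)) : ℝ :=
  sInf { r | ∃ w ∈ S, w.2 ≤ z.2 ∧ r = max (dist z.1 w.1) (Real.sqrt (z.2 - w.2)) }

end

theorem rpow_add_one_of_nonneg {p : ℝ} (hp : 0 ≤ p) (x : ℝ≥0∞) : x ^ (p + 1) = x ^ p * x := by
  rw [ENNReal.rpow_add_of_nonneg _ _ hp zero_le_one, ENNReal.rpow_one]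

theorem measure_setOf_measure_Iio_le (ν : Measure ℝ) [NullSingletonClass ν] (c : ℝ≥0∞) :
    ν {ρ | ν (Iio ρ) ≤ c} ≤ c := by
  set S := {ρ | ν (Iio ρ) ≤ c} with hS
  have hlow : ∀ x ∈ S, ∀ y ≤ x, y ∈ S := fun x hx y hy =>
    (measure_mono (Iio_subset_Iio hy)).trans hx
  rcases S.eq_empty_or_nonempty with he | hne
  · simp [he]
  by_cases hb : BddAbove S
  · have hsub : S ⊆ Iic (sSup S) := fun x hx => le_csSup hb hx
    obtain ⟨u, hu, hlt, hlim⟩ := exists_seq_strictMono_tendsto (sSup S)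
    have hun : Iio (sSup S) = ⋃ n, Iio (u n) := by
      ext y
      simp only [mem_Iio, mem_iUnion]
      constructor
      · intro hy
        exact (hlim.eventually_const_lt hy).exists
      · rintro ⟨n, hn⟩
        exact hn.trans (hlt n)
    calc ν S ≤ ν (Iic (sSup S)) := measure_mono hsub
      _ = ν (Iio (sSup S)) := measure_congr Iio_ae_eq_Iic.symm
      _ = ⨆ n, ν (Iio (u n)) := by
        rw [hun]
        exact Monotone.measure_iUnion fun a b hab => Iio_subset_Iio (hu.monotone hab)
      _ ≤ c := iSup_le fun n => by
        obtain ⟨x, hx, hux⟩ := exists_lt_of_lt_csSup hne (hlt n)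
        exact hlow x hx _ hux.le
  · have hun : (univ : Set ℝ) = ⋃ n : ℕ, Iio (n : ℝ) := by
      ext y
      simpa using exists_nat_gt y
    calc ν S ≤ ν univ := measure_mono (subset_univ _)
      _ = ⨆ n : ℕ, ν (Iio (n : ℝ)) := by
        rw [hun]
        exact Monotone.measure_iUnion fun a b hab => Iio_subset_Iio (by exact_mod_cast hab)
      _ ≤ c := iSup_le fun n => by
        obtain ⟨x, hx, hux⟩ := not_bddAbove_iff.1 hb n
        exact hlow x hx _ hux.le

theorem measure_univ_rpow_le_lintegral_measure_Iio (ν : Measure ℝ) [NullSingletonClass ν] {p : ℝ}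
    (hp : 0 < p) : ν univ ^ (p + 1) ≤ 2 ^ (p + 1) * ∫⁻ ρ, ν (Iio ρ) ^ p ∂ν := by
  have key : ∀ c : ℝ≥0∞, c ≠ ⊤ → c ^ p * (ν univ - c) ≤ ∫⁻ ρ, ν (Iio ρ) ^ p ∂ν := by
    intro c hc
    have hmono : Monotone fun ρ => ν (Iio ρ) := fun a b hab =>
      measure_mono (Iio_subset_Iio hab)
    have hmeas : MeasurableSet {ρ | ν (Iio ρ) ≤ c} :=
      measurableSet_le hmono.measurable measurable_const
    have hle := measure_setOf_measure_Iio_le ν c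
    have hcompl : ν univ - c ≤ ν {ρ | ν (Iio ρ) ≤ c}ᶜ := by
      rw [tsub_le_iff_right, ← measure_add_measure_compl hmeas, add_comm]
      gcongr
    calc c ^ p * (ν univ - c) ≤ c ^ p * ν {ρ | ν (Iio ρ) ≤ c}ᶜ := by gcongr
      _ = ∫⁻ _ in {ρ | ν (Iio ρ) ≤ c}ᶜ, c ^ p ∂ν := by rw [setLIntegral_const]
      _ ≤ ∫⁻ ρ in {ρ | ν (Iio ρ) ≤ c}ᶜ, ν (Iio ρ) ^ p ∂ν := by
        refine setLIntegral_mono' hmeas.compl fun ρ hρ => ?_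
        have : c < ν (Iio ρ) := not_le.1 hρ
        gcongr
      _ ≤ _ := setLIntegral_le_lintegral _ _
  by_cases htop : ν univ = ⊤
  · have h1 := key 1 (by simp)
    simp only [htop, ENNReal.one_rpow, one_mul] at h1
    rw [ENNReal.top_sub (by simp), top_le_iff] at h1
    rw [h1, ENNReal.mul_top (by simp)]
    exact le_top
  · have h2 := key (ν univ / 2) (ENNReal.div_ne_top htop (by simp))
    rw [ENNReal.sub_half htop] at h2
    calc ν univ ^ (p + 1) = (2 * (ν univ / 2)) ^ (p + 1) := by
          rw [ENNReal.mul_div_cancel (by simp) (by simp)]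
      _ = 2 ^ (p + 1) * ((ν univ / 2) ^ p * (ν univ / 2)) := by
        rw [ENNReal.mul_rpow_of_nonneg _ _ (by positivity),
          rpow_add_one_of_nonneg hp.le, rpow_add_one_of_nonneg hp.le]
      _ ≤ _ := by gcongr

theorem setLIntegral_rpow_le_lintegral_mul_primitive {f : ℝ → ℝ≥0∞} (hf : Measurable f)
    (R : ℝ) {p : ℝ} (hp : 0 < p) :
    (∫⁻ ρ in Ioo 0 R, f ρ) ^ (p + 1) ≤
      2 ^ (p + 1) * ∫⁻ ρ in Ioo 0 R, f ρ * (∫⁻ σ in Ioo 0 ρ, f σ) ^ p := by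
  have hν := measure_univ_rpow_le_lintegral_measure_Iio
    ((volume.restrict (Ioo 0 R)).withDensity f) hp
  rw [withDensity_apply _ MeasurableSet.univ, Measure.restrict_univ] at hν
  refine hν.trans (mul_le_mul' le_rfl ?_)
  refine (lintegral_withDensity_le_lintegral_mul _ hf _).trans ?_
  refine setLIntegral_mono' measurableSet_Ioo fun ρ hρ => ?_
  simp only [Pi.mul_apply]
  gcongr
  rw [withDensity_apply _ measurableSet_Iio, Measure.restrict_restrict measurableSet_Iio]
  exact lintegral_mono_set fun σ hσ => ⟨hσ.2.1, hσ.1⟩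

theorem mem_pQt_comm {N : ℕ} {r : ℝ} {z w : PSpace N} : w ∈ pQt N r z ↔ z ∈ pQt N r w := by
  simp only [pQt, mem_prod, mem_ball, mem_Ioo, dist_comm]
  constructor <;> rintro ⟨h1, h2, h3⟩ <;> exact ⟨h1, by linarith, by linarith⟩

theorem pQt_subset_pQt {N : ℕ} {r s R : ℝ} (hr : 0 ≤ r) (hs : 0 ≤ s) (hR : r + s ≤ R)
    {z w : PSpace N} (hz : z ∈ pQt N r w) : pQt N s z ⊆ pQt N R w := by
  rintro y ⟨h1, h2⟩
  obtain ⟨h3, h4⟩ := hz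
  simp only [mem_ball, mem_Ioo] at h1 h2 h3 h4
  have h5 : r ^ 2 + s ^ 2 ≤ R ^ 2 := by nlinarith [mul_nonneg hr hs]
  refine ⟨?_, ?_, ?_⟩
  · exact mem_ball.2 ((dist_triangle _ z.1 _).trans_lt (by linarith))
  · linarith
  · linarith

theorem pQt_mono {N : ℕ} {r s : ℝ} (hr : 0 ≤ r) (hrs : r ≤ s) (z : PSpace N) :
    pQt N r z ⊆ pQt N s z :=
  prod_mono (ball_subset_ball hrs) (Ioo_subset_Ioo (by nlinarith) (by nlinarith))

theorem isOpen_pQt {N : ℕ} (r : ℝ) (z : PSpace N) : IsOpen (pQt N r z) :=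
  isOpen_ball.prod isOpen_Ioo

theorem isOpen_setOf_mem_pQt (N : ℕ) :
    IsOpen {x : (ℝ × PSpace N) × PSpace N | x.2 ∈ pQt N x.1.1 x.1.2} := by
  have : {x : (ℝ × PSpace N) × PSpace N | x.2 ∈ pQt N x.1.1 x.1.2} =
      {x | dist x.2.1 x.1.2.1 < x.1.1} ∩
        ({x | x.1.2.2 - x.1.1 ^ 2 < x.2.2} ∩ {x | x.2.2 < x.1.2.2 + x.1.1 ^ 2}) := rfl
  rw [this]
  refine (isOpen_lt ?_ ?_).inter ((isOpen_lt ?_ ?_).inter (isOpen_lt ?_ ?_)) <;> fun_prop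

theorem measurable_measure_pQt {N : ℕ} (μ : Measure (PSpace N)) [SFinite μ] :
    Measurable fun x : ℝ × PSpace N => μ (pQt N x.1 x.2) :=
  measurable_measure_prodMk_left (isOpen_setOf_mem_pQt N).measurableSet

theorem volume_pQt {N : ℕ} (hN : 2 ≤ N) {r : ℝ} (hr : 0 ≤ r) (z : PSpace N) :
    volume (pQt N r z) =
      ENNReal.ofReal (r ^ (N + 2)) * (2 * volume (ball (0 : EuclideanSpace ℝ (Fin N)) 1)) := by
  have : Nonempty (Fin N) := ⟨⟨0, by omega⟩⟩
  rw [pQt, Measure.volume_eq_prod, Measure.prod_prod, Measure.addHaar_ball _ _ hr,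
    Real.volume_Ioo, finrank_euclideanSpace, Fintype.card_fin,
    show z.2 + r ^ 2 - (z.2 - r ^ 2) = 2 * r ^ 2 by ring,
    ENNReal.ofReal_mul (by norm_num : (0 : ℝ) ≤ 2), ENNReal.ofReal_ofNat, pow_add,
    ENNReal.ofReal_mul (by positivity)]
  ring

theorem exists_finset_pQt_subset_iUnion (N : ℕ) (k : ℝ) : ∃ V : Finset (PSpace N), ∀ r > 0,
    ∀ z : PSpace N, pQt N (k * r) z ⊆ ⋃ v ∈ V, pQt N r (z + (r • v.1, r ^ 2 * v.2)) := by
  have hK : IsCompact (closedBall (0 : EuclideanSpace ℝ (Fin N)) k ×ˢ Icc (-k ^ 2) (k ^ 2)) :=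
    (isCompact_closedBall _ _).prod isCompact_Icc
  obtain ⟨V, -, hV⟩ := hK.elim_nhds_subcover (pQt N 1) fun v _ =>
    (isOpen_pQt 1 v).mem_nhds ⟨mem_ball_self one_pos, by simp, by simp⟩
  refine ⟨V, fun r hr z y hy => ?_⟩
  obtain ⟨h1, h2, h3⟩ := hy
  have hscale : r ^ 2 * (r ^ 2)⁻¹ = 1 := mul_inv_cancel₀ (by positivity)
  have hu : ((r⁻¹ • (y.1 - z.1), (r ^ 2)⁻¹ * (y.2 - z.2)) : PSpace N) ∈
      closedBall (0 : EuclideanSpace ℝ (Fin N)) k ×ˢ Icc (-k ^ 2) (k ^ 2) := by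
    refine ⟨?_, ?_, ?_⟩
    · rw [mem_closedBall_zero_iff, norm_smul, norm_inv, Real.norm_of_nonneg hr.le,
        ← dist_eq_norm, inv_mul_le_iff₀ hr]
      linarith [mem_ball.1 h1]
    · simp only
      rw [le_inv_mul_iff₀ (by positivity)]
      nlinarith
    · simp only
      rw [inv_mul_le_iff₀ (by positivity)]
      nlinarith
  obtain ⟨v, hv, hvu⟩ := mem_iUnion₂.1 (hV hu)
  refine mem_iUnion₂.2 ⟨v, hv, ?_⟩
  obtain ⟨h4, h5, h6⟩ := hvu
  simp only [mem_ball, dist_eq_norm, one_pow] at h4 h5 h6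
  refine ⟨?_, ?_, ?_⟩
  · rw [mem_ball, dist_eq_norm]
    have : y.1 - (z + (r • v.1, r ^ 2 * v.2)).1 = r • (r⁻¹ • (y.1 - z.1) - v.1) := by
      rw [smul_sub, smul_inv_smul₀ hr.ne']
      simp only [Prod.fst_add]
      abel
    rw [this, norm_smul, Real.norm_of_nonneg hr.le]
    nlinarith
  · have := mul_lt_mul_of_pos_left h5 (show 0 < r ^ 2 by positivity)
    rw [← mul_assoc, hscale] at this
    simp only [Prod.snd_add]
    linarith
  · have := mul_lt_mul_of_pos_left h6 (show 0 < r ^ 2 by positivity)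
    rw [← mul_assoc, hscale] at this
    simp only [Prod.snd_add]
    linarith

/-- Lebesgue measure of the unit parabolic cylinder `Q̃_1`. -/
noncomputable def pUnitVol (N : ℕ) : ℝ≥0∞ := 2 * volume (ball (0 : EuclideanSpace ℝ (Fin N)) 1)

theorem pUnitVol_ne_top (N : ℕ) : pUnitVol N ≠ ⊤ :=
  ENNReal.mul_ne_top (by simp) measure_ball_lt_top.ne

theorem pUnitVol_ne_zero (N : ℕ) : pUnitVol N ≠ 0 :=
  mul_ne_zero (by simp) (measure_ball_pos _ _ one_pos).ne'

theorem measurableSet_setOf_mem_pQt (N : ℕ) (r : ℝ) :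
    MeasurableSet {x : PSpace N × PSpace N | x.2 ∈ pQt N r x.1} :=
  ((isOpen_setOf_mem_pQt N).preimage
    (f := fun x : PSpace N × PSpace N => ((r, x.1), x.2)) (by fun_prop)).measurableSet

theorem measurable_measure_pQt_comp {N : ℕ} (μ : Measure (PSpace N)) [SFinite μ] {α : Type*}
    [MeasurableSpace α] {f : α → ℝ} {g : α → PSpace N} (hf : Measurable f) (hg : Measurable g) :
    Measurable fun a => μ (pQt N (f a) (g a)) := by
  simpa only [Function.comp_def] using (measurable_measure_pQt μ).comp (hf.prodMk hg)

theorem measurable_measure_pQt_div {N : ℕ} (μ : Measure (PSpace N)) [SFinite μ] {α : Type*}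
    [MeasurableSpace α] {f : α → ℝ} {g : α → PSpace N} (hf : Measurable f) (hg : Measurable g) :
    Measurable fun a => μ (pQt N (f a) (g a)) / ENNReal.ofReal (f a ^ (N + 1)) :=
  (measurable_measure_pQt_comp μ hf hg).div (hf.pow_const _).ennreal_ofReal

theorem measurable_measure_pQt_right {N : ℕ} (μ : Measure (PSpace N)) [SFinite μ] (r : ℝ) :
    Measurable fun z => μ (pQt N r z) :=
  measurable_measure_pQt_comp μ measurable_const measurable_id

theorem lintegral_mul_measure_pQt {N : ℕ} (μ : Measure (PSpace N)) [SFinite μ]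
    {g : PSpace N → ℝ≥0∞} (hg : Measurable g) (r : ℝ) :
    ∫⁻ z, g z * μ (pQt N r z) = ∫⁻ w, ∫⁻ z in pQt N r w, g z ∂volume ∂μ := by
  have hmeas : Measurable (Function.uncurry fun z w : PSpace N =>
      (pQt N r z).indicator (fun _ => g z) w) :=
    (hg.comp measurable_fst).indicator (measurableSet_setOf_mem_pQt N r)
  calc ∫⁻ z, g z * μ (pQt N r z)
      = ∫⁻ z, ∫⁻ w, (pQt N r z).indicator (fun _ => g z) w ∂μ := by
        simp_rw [lintegral_indicator_const (isOpen_pQt r _).measurableSet]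
    _ = ∫⁻ w, ∫⁻ z, (pQt N r z).indicator (fun _ => g z) w ∂volume ∂μ :=
        lintegral_lintegral_swap hmeas.aemeasurable
    _ = ∫⁻ w, ∫⁻ z in pQt N r w, g z ∂volume ∂μ := by
        refine lintegral_congr fun w => ?_
        rw [← lintegral_indicator (isOpen_pQt r w).measurableSet]
        refine lintegral_congr fun z => ?_
        by_cases h : w ∈ pQt N r z
        · rw [indicator_of_mem h, indicator_of_mem (mem_pQt_comm.1 h)]
        · rw [indicator_of_notMem h, indicator_of_notMem fun h' => h (mem_pQt_comm.1 h')]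

section Comparison

variable {N : ℕ} (μ : Measure (PSpace N)) [SFinite μ] {p r : ℝ}

theorem lintegral_measure_pQt_rpow_le (hN : 2 ≤ N) (hp : 0 ≤ p) (hr : 0 ≤ r) :
    ∫⁻ z, μ (pQt N r z) ^ (p + 1) ≤
      ENNReal.ofReal (r ^ (N + 2)) * pUnitVol N * ∫⁻ w, μ (pQt N (2 * r) w) ^ p ∂μ := by
  simp_rw [rpow_add_one_of_nonneg hp]
  rw [lintegral_mul_measure_pQt μ ((measurable_measure_pQt_right μ r).pow_const p),
    ← lintegral_const_mul _ ((measurable_measure_pQt_right μ _).pow_const p)]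
  refine lintegral_mono fun w => ?_
  calc ∫⁻ z in pQt N r w, μ (pQt N r z) ^ p
      ≤ ∫⁻ _ in pQt N r w, μ (pQt N (2 * r) w) ^ p := by
        refine setLIntegral_mono' (isOpen_pQt r w).measurableSet fun z hz => ?_
        gcongr
        exact pQt_subset_pQt hr hr (by linarith) hz
    _ = _ := by rw [setLIntegral_const, volume_pQt hN hr, mul_comm, pUnitVol]

theorem volume_mul_lintegral_measure_pQt_rpow_le (hN : 2 ≤ N) (hp : 0 ≤ p) (hr : 0 ≤ r) :
    ENNReal.ofReal (r ^ (N + 2)) * pUnitVol N * ∫⁻ w, μ (pQt N r w) ^ p ∂μ ≤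
      ∫⁻ z, μ (pQt N (2 * r) z) ^ (p + 1) := by
  calc _ = ∫⁻ w, ∫⁻ _ in pQt N r w, μ (pQt N r w) ^ p ∂volume ∂μ := by
        rw [← lintegral_const_mul _ ((measurable_measure_pQt_right μ _).pow_const p)]
        refine lintegral_congr fun w => ?_
        rw [setLIntegral_const, volume_pQt hN hr, mul_comm, pUnitVol]
    _ ≤ ∫⁻ w, ∫⁻ z in pQt N r w, μ (pQt N (2 * r) z) ^ p ∂volume ∂μ := by
        refine lintegral_mono fun w =>
          setLIntegral_mono' (isOpen_pQt r w).measurableSet fun z hz => ?_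
        gcongr
        exact pQt_subset_pQt hr hr (by linarith) (mem_pQt_comm.1 hz)
    _ = ∫⁻ z, μ (pQt N (2 * r) z) ^ p * μ (pQt N r z) :=
        (lintegral_mul_measure_pQt μ ((measurable_measure_pQt_right μ _).pow_const p) r).symm
    _ ≤ _ := by
        refine lintegral_mono fun z => ?_
        rw [rpow_add_one_of_nonneg hp]
        gcongr
        exact pQt_mono hr (by linarith) z

end Comparison

instance isAddRightInvariant_volume_pSpace (N : ℕ) :
    (volume : Measure (PSpace N)).IsAddRightInvariant := by
  rw [Measure.volume_eq_prod]
  infer_instance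

theorem exists_lintegral_measure_pQt_dilate_le (N : ℕ) (k : ℝ) {s : ℝ} (hs : 1 ≤ s) :
    ∃ K : ℝ≥0∞, K ≠ ⊤ ∧ ∀ (μ : Measure (PSpace N)) [SFinite μ], ∀ r > 0,
      ∫⁻ z, μ (pQt N (k * r) z) ^ s ≤ K * ∫⁻ z, μ (pQt N r z) ^ s := by
  obtain ⟨V, hV⟩ := exists_finset_pQt_subset_iUnion N k
  refine ⟨(V.card : ℝ≥0∞) ^ (s - 1) * V.card, ?_, fun μ _ r hr => ?_⟩
  · exact ENNReal.mul_ne_top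
      (ENNReal.rpow_ne_top_of_nonneg (by linarith) (ENNReal.natCast_ne_top _))
      (ENNReal.natCast_ne_top _)
  have hmeas : Measurable fun z => μ (pQt N r z) ^ s :=
    (measurable_measure_pQt_right μ r).pow_const s
  calc ∫⁻ z, μ (pQt N (k * r) z) ^ s
      ≤ ∫⁻ z, (V.card : ℝ≥0∞) ^ (s - 1) *
          ∑ v ∈ V, μ (pQt N r (z + (r • v.1, r ^ 2 * v.2))) ^ s := by
        refine lintegral_mono fun z => ?_
        refine le_trans ?_ (ENNReal.rpow_sum_le_const_mul_sum_rpow V _ hs)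
        gcongr
        exact (measure_mono (hV r hr z)).trans (measure_biUnion_finset_le _ _)
    _ = (V.card : ℝ≥0∞) ^ (s - 1) *
          ∑ v ∈ V, ∫⁻ z, μ (pQt N r (z + (r • v.1, r ^ 2 * v.2))) ^ s := by
        have hm : ∀ v : PSpace N,
            Measurable fun z => μ (pQt N r (z + (r • v.1, r ^ 2 * v.2))) ^ s :=
          fun v => hmeas.comp (measurable_add_const _)
        rw [lintegral_const_mul _ (Finset.measurable_sum _ fun v _ => hm v),
          lintegral_finsetSum _ fun v _ => hm v]
    _ = _ := by
        rw [Finset.sum_congr rfl fun v _ =>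
          lintegral_add_right_eq_self (fun z => μ (pQt N r z) ^ s) _, Finset.sum_const, nsmul_eq_mul, mul_assoc]

theorem exists_volume_mul_lintegral_le_half {N : ℕ} (hN : 2 ≤ N) {p : ℝ} (hp : 0 ≤ p) :
    ∃ K : ℝ≥0∞, K ≠ ⊤ ∧ ∀ (μ : Measure (PSpace N)) [SFinite μ], ∀ r > 0,
      ENNReal.ofReal (r ^ (N + 2)) * pUnitVol N * ∫⁻ w, μ (pQt N r w) ^ p ∂μ ≤
        K * ∫⁻ z, μ (pQt N (r / 2) z) ^ (p + 1) := by
  obtain ⟨K, hK, h⟩ := exists_lintegral_measure_pQt_dilate_le N 4 (show 1 ≤ p + 1 by linarith)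
  refine ⟨K, hK, fun μ _ r hr => ?_⟩
  refine (volume_mul_lintegral_measure_pQt_rpow_le μ hN hp hr.le).trans ?_
  rw [show 2 * r = 4 * (r / 2) by ring]
  exact h μ (r / 2) (half_pos hr)

theorem exists_lintegral_measure_pQt_two_mul_le {N : ℕ} (hN : 2 ≤ N) {p : ℝ} (hp : 0 ≤ p) :
    ∃ K : ℝ≥0∞, K ≠ ⊤ ∧ ∀ (μ : Measure (PSpace N)) [SFinite μ], ∀ r > 0,
      ∫⁻ w, μ (pQt N (2 * r) w) ^ p ∂μ ≤ K * ∫⁻ w, μ (pQt N r w) ^ p ∂μ := by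
  obtain ⟨K, hK, h⟩ := exists_lintegral_measure_pQt_dilate_le N 8 (show 1 ≤ p + 1 by linarith)
  refine ⟨K, hK, fun μ _ r hr => ?_⟩
  have hvol : ENNReal.ofReal ((2 * r) ^ (N + 2)) * pUnitVol N ≠ 0 :=
    mul_ne_zero (by rw [Ne, ENNReal.ofReal_eq_zero, not_le]; positivity) (pUnitVol_ne_zero N)
  have hvol' : ENNReal.ofReal ((2 * r) ^ (N + 2)) * pUnitVol N ≠ ⊤ :=
    ENNReal.mul_ne_top (by simp) (pUnitVol_ne_top N)
  rw [← ENNReal.mul_le_mul_iff_right hvol hvol']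
  calc _ ≤ ∫⁻ z, μ (pQt N (2 * (2 * r)) z) ^ (p + 1) :=
        volume_mul_lintegral_measure_pQt_rpow_le μ hN hp (by positivity)
    _ = ∫⁻ z, μ (pQt N (8 * (r / 2)) z) ^ (p + 1) := by ring_nf
    _ ≤ K * ∫⁻ z, μ (pQt N (r / 2) z) ^ (p + 1) := h μ _ (half_pos hr)
    _ ≤ K * (ENNReal.ofReal ((r / 2) ^ (N + 2)) * pUnitVol N *
          ∫⁻ w, μ (pQt N (2 * (r / 2)) w) ^ p ∂μ) := by
        gcongr
        exact lintegral_measure_pQt_rpow_le μ hN hp (by positivity)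
    _ ≤ K * (ENNReal.ofReal ((2 * r) ^ (N + 2)) * pUnitVol N *
          ∫⁻ w, μ (pQt N r w) ^ p ∂μ) := by
        rw [mul_div_cancel₀ r two_ne_zero]
        gcongr
        linarith
    _ = _ := by ring

theorem lintegral_pQt_riesz_le {N : ℕ} (hN : 2 ≤ N) (μ : Measure (PSpace N)) [SFinite μ]
    {r : ℝ} (hr : 0 < r) (w : PSpace N) :
    ∫⁻ z in pQt N r w, riesz N r μ z ≤
      pUnitVol N * ENNReal.ofReal (r ^ 2) * μ (pQt N (2 * r) w) := by
  have hinner : ∀ σ ∈ Ioo 0 r, ∫⁻ z in pQt N r w, μ (pQt N σ z) / ENNReal.ofReal (σ ^ (N + 1)) ≤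
      pUnitVol N * ENNReal.ofReal r * μ (pQt N (2 * r) w) := by
    intro σ hσ
    have hrestr : ∫⁻ z in pQt N r w, μ (pQt N σ z) ≤
        ENNReal.ofReal (σ ^ (N + 2)) * pUnitVol N * μ (pQt N (2 * r) w) := by
      calc ∫⁻ z in pQt N r w, μ (pQt N σ z)
          = ∫⁻ z in pQt N r w, 1 * μ.restrict (pQt N (2 * r) w) (pQt N σ z) := by
            refine setLIntegral_congr_fun (isOpen_pQt r w).measurableSet fun z hz => ?_
            simp only [one_mul]
            rw [Measure.restrict_eq_self]
            exact pQt_subset_pQt hr.le hσ.1.le (by linarith [hσ.2]) hz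
        _ ≤ ∫⁻ z, 1 * μ.restrict (pQt N (2 * r) w) (pQt N σ z) := setLIntegral_le_lintegral _ _
        _ = _ := by
            rw [lintegral_mul_measure_pQt _ measurable_const]
            simp_rw [setLIntegral_one, volume_pQt hN hσ.1.le]
            rw [setLIntegral_const, pUnitVol]
    simp_rw [div_eq_mul_inv]
    rw [lintegral_mul_const _ (measurable_measure_pQt_right μ σ)]
    have hσ' : ENNReal.ofReal (σ ^ (N + 1)) ≠ 0 := by
      rw [Ne, ENNReal.ofReal_eq_zero, not_le]
      exact pow_pos hσ.1 _
    calc _ ≤ ENNReal.ofReal (σ ^ (N + 2)) * pUnitVol N * μ (pQt N (2 * r) w) *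
          (ENNReal.ofReal (σ ^ (N + 1)))⁻¹ := by gcongr
      _ = pUnitVol N * ENNReal.ofReal σ * μ (pQt N (2 * r) w) *
          (ENNReal.ofReal (σ ^ (N + 1)) * (ENNReal.ofReal (σ ^ (N + 1)))⁻¹) := by
        rw [pow_succ σ (N + 1), ENNReal.ofReal_mul (pow_nonneg hσ.1.le _)]
        ring
      _ ≤ pUnitVol N * ENNReal.ofReal r * μ (pQt N (2 * r) w) := by
        rw [ENNReal.mul_inv_cancel hσ' ENNReal.ofReal_ne_top, mul_one]
        gcongr
        exact hσ.2.le
  unfold riesz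
  rw [lintegral_lintegral_swap]
  · calc _ ≤ ∫⁻ _ in Ioo 0 r, pUnitVol N * ENNReal.ofReal r * μ (pQt N (2 * r) w) :=
          setLIntegral_mono' measurableSet_Ioo hinner
      _ = _ := by
        rw [setLIntegral_const, Real.volume_Ioo, sub_zero, sq, ENNReal.ofReal_mul hr.le]
        ring
  · exact (measurable_measure_pQt_div μ measurable_snd measurable_fst).aemeasurable

theorem measure_pQt_half_div_le_riesz {N : ℕ} (μ : Measure (PSpace N)) {r R : ℝ} (hr : 0 < r)
    (hrR : r ≤ R) (z : PSpace N) :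
    μ (pQt N (r / 2) z) / ENNReal.ofReal (r ^ N) ≤ 2 * riesz N R μ z := by
  have hr0 : ENNReal.ofReal r ≠ 0 := by simpa using hr
  have hrN : ENNReal.ofReal (r ^ N) ≠ 0 := by
    rw [Ne, ENNReal.ofReal_eq_zero, not_le]
    exact pow_pos hr _
  have hlow : μ (pQt N (r / 2) z) / ENNReal.ofReal (r ^ (N + 1)) * ENNReal.ofReal (r / 2) ≤
      riesz N R μ z := by
    calc _ = ∫⁻ _ in Ioo (r / 2) r, μ (pQt N (r / 2) z) / ENNReal.ofReal (r ^ (N + 1)) := by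
          rw [setLIntegral_const, Real.volume_Ioo, sub_half]
      _ ≤ ∫⁻ ρ in Ioo (r / 2) r, μ (pQt N ρ z) / ENNReal.ofReal (ρ ^ (N + 1)) := by
          refine setLIntegral_mono' measurableSet_Ioo fun ρ hρ => ?_
          have hρ0 : 0 < ρ := (half_pos hr).trans hρ.1
          gcongr
          · exact pQt_mono (half_pos hr).le hρ.1.le z
          · exact hρ.2.le
      _ ≤ riesz N R μ z := lintegral_mono_set (Ioo_subset_Ioo (half_pos hr).le hrR)
  refine le_trans (le_of_eq ?_) (mul_le_mul' le_rfl hlow)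
  have h2 : 2 * ENNReal.ofReal (r / 2) = ENNReal.ofReal r := by
    rw [← ENNReal.ofReal_ofNat 2, ← ENNReal.ofReal_mul (by norm_num), mul_div_cancel₀ _ two_ne_zero]
  calc _ = μ (pQt N (r / 2) z) * (ENNReal.ofReal (r ^ N))⁻¹ *
        (ENNReal.ofReal r * (ENNReal.ofReal r)⁻¹) := by
        rw [ENNReal.mul_inv_cancel hr0 ENNReal.ofReal_ne_top, mul_one, div_eq_mul_inv]
    _ = μ (pQt N (r / 2) z) / ENNReal.ofReal (r ^ (N + 1)) * (2 * ENNReal.ofReal (r / 2)) := by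
        rw [h2, pow_succ r N, ENNReal.ofReal_mul (pow_nonneg hr.le _), div_eq_mul_inv (μ _),
          ENNReal.mul_inv (Or.inl hrN) (Or.inl ENNReal.ofReal_ne_top)]
        ring
    _ = _ := by ring

section RieszEnergy

variable {N : ℕ} (μ : Measure (PSpace N)) [SFinite μ] {p : ℝ}

theorem measurable_riesz_uncurry : Measurable fun x : ℝ × PSpace N => riesz N x.1 μ x.2 := by
  have hset : MeasurableSet {y : (ℝ × PSpace N) × ℝ | y.2 ∈ Ioo 0 y.1.1} :=
    (measurableSet_lt measurable_const measurable_snd).inter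
      (measurableSet_lt measurable_snd measurable_fst.fst)
  have hmeas := (measurable_measure_pQt_div μ (α := (ℝ × PSpace N) × ℝ) measurable_snd
    measurable_fst.snd).indicator hset
  convert! hmeas.lintegral_prod_right' (ν := volume) using 2 with x
  rw [riesz, ← lintegral_indicator measurableSet_Ioo]
  rfl

theorem measurable_riesz_comp {α : Type*} [MeasurableSpace α] {f : α → ℝ} {g : α → PSpace N}
    (hf : Measurable f) (hg : Measurable g) : Measurable fun a => riesz N (f a) μ (g a) := by
  simpa only [Function.comp_def] using (measurable_riesz_uncurry μ).comp (hf.prodMk hg)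

theorem measurable_riesz (R : ℝ) : Measurable (riesz N R μ) :=
  measurable_riesz_comp μ measurable_const measurable_id

theorem setLIntegral_pQt_riesz_rpow_le (hN : 2 ≤ N) (hp : 0 ≤ p) (hp1 : p ≤ 1)
    (hNp : N * p = 2) {r : ℝ} (hr : 0 < r) (w : PSpace N) :
    ∫⁻ z in pQt N r w, riesz N r μ z ^ p ≤
      pUnitVol N * ENNReal.ofReal (r ^ N) * μ (pQt N (2 * r) w) ^ p := by
  have hr0 : ENNReal.ofReal r ≠ 0 := by simpa using hr
  have hpow : ENNReal.ofReal (r ^ 2) ^ p * ENNReal.ofReal (r ^ (N + 2)) ^ (1 - p) =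
      ENNReal.ofReal (r ^ N) := by
    simp_rw [ENNReal.ofReal_pow hr.le, ← ENNReal.rpow_natCast]
    rw [← ENNReal.rpow_mul, ← ENNReal.rpow_mul, ← ENNReal.rpow_add _ _ hr0 ENNReal.ofReal_ne_top]
    congr 1
    push_cast
    linarith
  have hv : pUnitVol N ^ p * pUnitVol N ^ (1 - p) = pUnitVol N := by
    rw [← ENNReal.rpow_add _ _ (pUnitVol_ne_zero N) (pUnitVol_ne_top N), add_sub_cancel,
      ENNReal.rpow_one]
  calc ∫⁻ z in pQt N r w, riesz N r μ z ^ p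
      = ∫⁻ z in pQt N r w, riesz N r μ z ^ p * 1 ^ (1 - p) := by simp
    _ ≤ (∫⁻ z in pQt N r w, riesz N r μ z) ^ p * (∫⁻ _ in pQt N r w, 1) ^ (1 - p) :=
        ENNReal.lintegral_mul_norm_pow_le (measurable_riesz μ r).aemeasurable
          aemeasurable_const hp (sub_nonneg.2 hp1) (add_sub_cancel _ _)
    _ ≤ (pUnitVol N * ENNReal.ofReal (r ^ 2) * μ (pQt N (2 * r) w)) ^ p *
          (ENNReal.ofReal (r ^ (N + 2)) * pUnitVol N) ^ (1 - p) := by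
        rw [setLIntegral_one, volume_pQt hN hr.le, pUnitVol]
        gcongr
        exact lintegral_pQt_riesz_le hN μ hr w
    _ = (pUnitVol N ^ p * pUnitVol N ^ (1 - p)) *
          (ENNReal.ofReal (r ^ 2) ^ p * ENNReal.ofReal (r ^ (N + 2)) ^ (1 - p)) *
          μ (pQt N (2 * r) w) ^ p := by
        rw [ENNReal.mul_rpow_of_nonneg _ _ hp, ENNReal.mul_rpow_of_nonneg _ _ hp,
          ENNReal.mul_rpow_of_nonneg _ _ (sub_nonneg.2 hp1)]
        ring
    _ = _ := by rw [hpow, hv]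

theorem lintegral_riesz_rpow_le (hN : 2 ≤ N) (hp : 0 < p) (hp1 : p ≤ 1) (hNp : N * p = 2)
    (R : ℝ) :
    ∫⁻ z, riesz N R μ z ^ (p + 1) ≤ 2 ^ (p + 1) * pUnitVol N *
      ∫⁻ r in Ioo 0 R, (∫⁻ w, μ (pQt N (2 * r) w) ^ p ∂μ) / ENNReal.ofReal r := by
  have hmeas : Measurable fun x : PSpace N × ℝ =>
      μ (pQt N x.2 x.1) / ENNReal.ofReal (x.2 ^ (N + 1)) * riesz N x.2 μ x.1 ^ p :=
    (measurable_measure_pQt_div μ measurable_snd measurable_fst).mul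
      ((measurable_riesz_comp μ measurable_snd measurable_fst).pow_const p)
  calc ∫⁻ z, riesz N R μ z ^ (p + 1)
      ≤ ∫⁻ z, 2 ^ (p + 1) * ∫⁻ r in Ioo 0 R,
          μ (pQt N r z) / ENNReal.ofReal (r ^ (N + 1)) * riesz N r μ z ^ p :=
        lintegral_mono fun z => setLIntegral_rpow_le_lintegral_mul_primitive
          (measurable_measure_pQt_div μ measurable_id measurable_const) R hp
    _ = 2 ^ (p + 1) * ∫⁻ r in Ioo 0 R, ∫⁻ z,
          μ (pQt N r z) / ENNReal.ofReal (r ^ (N + 1)) * riesz N r μ z ^ p := by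
        rw [lintegral_const_mul _ hmeas.lintegral_prod_right',
          lintegral_lintegral_swap hmeas.aemeasurable]
    _ ≤ 2 ^ (p + 1) * ∫⁻ r in Ioo 0 R, pUnitVol N *
          ((∫⁻ w, μ (pQt N (2 * r) w) ^ p ∂μ) / ENNReal.ofReal r) := by
        refine mul_le_mul' le_rfl (setLIntegral_mono' measurableSet_Ioo fun r hr => ?_)
        have hr0 : ENNReal.ofReal (r ^ N) ≠ 0 := by
          rw [Ne, ENNReal.ofReal_eq_zero, not_le]
          exact pow_pos hr.1 _
        have hpm := (measurable_riesz μ r).pow_const p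
        calc ∫⁻ z, μ (pQt N r z) / ENNReal.ofReal (r ^ (N + 1)) * riesz N r μ z ^ p
            = (∫⁻ z, riesz N r μ z ^ p * μ (pQt N r z)) *
                (ENNReal.ofReal (r ^ (N + 1)))⁻¹ := by
              have hprod : Measurable fun z => riesz N r μ z ^ p * μ (pQt N r z) :=
                hpm.mul (measurable_measure_pQt_right μ r)
              rw [← lintegral_mul_const _ hprod]
              refine lintegral_congr fun z => ?_
              rw [div_eq_mul_inv]
              ring
          _ ≤ (∫⁻ w, pUnitVol N * ENNReal.ofReal (r ^ N) * μ (pQt N (2 * r) w) ^ p ∂μ) *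
                (ENNReal.ofReal (r ^ (N + 1)))⁻¹ := by
              rw [lintegral_mul_measure_pQt μ hpm]
              gcongr with w
              exact setLIntegral_pQt_riesz_rpow_le μ hN hp.le hp1 hNp hr.1 w
          _ = pUnitVol N * (∫⁻ w, μ (pQt N (2 * r) w) ^ p ∂μ) * (ENNReal.ofReal r)⁻¹ *
                (ENNReal.ofReal (r ^ N) * (ENNReal.ofReal (r ^ N))⁻¹) := by
              rw [lintegral_const_mul _ ((measurable_measure_pQt_right μ _).pow_const p),
                pow_succ, ENNReal.ofReal_mul (pow_nonneg hr.1.le _),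
                ENNReal.mul_inv (Or.inl hr0) (Or.inl ENNReal.ofReal_ne_top)]
              ring
          _ = _ := by
              rw [ENNReal.mul_inv_cancel hr0 ENNReal.ofReal_ne_top, mul_one, mul_assoc,
                div_eq_mul_inv]
    _ = _ := by
        rw [lintegral_const_mul' _ _ (pUnitVol_ne_top N), mul_assoc]

theorem lintegral_measure_pQt_half_rpow_le (hp : 0 ≤ p) (hNp : N * p = 2) (R : ℝ) :
    ∫⁻ r in Ioo 0 R, (∫⁻ z, μ (pQt N (r / 2) z) ^ (p + 1)) / ENNReal.ofReal (r ^ (N + 3)) ≤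
      2 ^ p * ∫⁻ z, riesz N R μ z ^ (p + 1) := by
  have hpt : ∀ r ∈ Ioo 0 R, ∀ z : PSpace N,
      μ (pQt N (r / 2) z) ^ (p + 1) / ENNReal.ofReal (r ^ (N + 3)) ≤
        (2 * riesz N R μ z) ^ p * (μ (pQt N r z) / ENNReal.ofReal (r ^ (N + 1))) := by
    intro r hr z
    have hr2 : ENNReal.ofReal (r ^ 2) ≠ 0 := by
      rw [Ne, ENNReal.ofReal_eq_zero, not_le]
      exact pow_pos hr.1 _
    have hpow : ENNReal.ofReal (r ^ N) ^ p = ENNReal.ofReal (r ^ 2) := by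
      simp_rw [ENNReal.ofReal_pow hr.1.le, ← ENNReal.rpow_natCast]
      rw [← ENNReal.rpow_mul, hNp]
      norm_num
    calc μ (pQt N (r / 2) z) ^ (p + 1) / ENNReal.ofReal (r ^ (N + 3))
        = (μ (pQt N (r / 2) z) / ENNReal.ofReal (r ^ N)) ^ p *
            (μ (pQt N (r / 2) z) / ENNReal.ofReal (r ^ (N + 1))) := by
          rw [ENNReal.div_rpow_of_nonneg _ _ hp, hpow, rpow_add_one_of_nonneg hp,
            show N + 3 = 2 + (N + 1) by ring, pow_add, ENNReal.ofReal_mul (sq_nonneg r)]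
          simp_rw [div_eq_mul_inv]
          rw [ENNReal.mul_inv (Or.inl hr2) (Or.inl ENNReal.ofReal_ne_top)]
          ring
      _ ≤ _ := by
          gcongr
          · exact measure_pQt_half_div_le_riesz μ hr.1 hr.2.le z
          · exact pQt_mono (half_pos hr.1).le (half_le_self hr.1.le) z
  have hmeas : Measurable fun x : ℝ × PSpace N =>
      (2 * riesz N R μ x.2) ^ p * (μ (pQt N x.1 x.2) / ENNReal.ofReal (x.1 ^ (N + 1))) :=
    (((measurable_riesz_comp μ measurable_const measurable_snd).const_mul 2).pow_const p).mul
      (measurable_measure_pQt_div μ measurable_fst measurable_snd)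
  calc _ ≤ ∫⁻ r in Ioo 0 R, ∫⁻ z,
        (2 * riesz N R μ z) ^ p * (μ (pQt N r z) / ENNReal.ofReal (r ^ (N + 1))) := by
        refine setLIntegral_mono' measurableSet_Ioo fun r hr => ?_
        rw [div_eq_mul_inv,
          ← lintegral_mul_const _ ((measurable_measure_pQt_right μ _).pow_const _)]
        exact lintegral_mono fun z => hpt r hr z
    _ = ∫⁻ z, ∫⁻ r in Ioo 0 R,
        (2 * riesz N R μ z) ^ p * (μ (pQt N r z) / ENNReal.ofReal (r ^ (N + 1))) :=
        lintegral_lintegral_swap hmeas.aemeasurable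
    _ = ∫⁻ z, 2 ^ p * riesz N R μ z ^ (p + 1) := by
        refine lintegral_congr fun z => ?_
        rw [lintegral_const_mul _ (measurable_measure_pQt_div μ (f := fun r => r) measurable_id measurable_const),
          ENNReal.mul_rpow_of_nonneg _ _ hp, rpow_add_one_of_nonneg hp, mul_assoc]
        rfl
    _ = _ := lintegral_const_mul _ ((measurable_riesz μ R).pow_const _)

theorem lintegral_wolff_swap (R : ℝ) :
    ∫⁻ z, (∫⁻ r in Ioo (0 : ℝ) R, μ (pQt N r z) ^ p / ENNReal.ofReal r) ∂μ =
      ∫⁻ r in Ioo (0 : ℝ) R, (∫⁻ w, μ (pQt N r w) ^ p ∂μ) / ENNReal.ofReal r := by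
  have hmeas : Measurable fun x : PSpace N × ℝ => μ (pQt N x.2 x.1) ^ p / ENNReal.ofReal x.2 :=
    ((measurable_measure_pQt_comp μ measurable_snd measurable_fst).pow_const p).div
      measurable_snd.ennreal_ofReal
  rw [lintegral_lintegral_swap hmeas.aemeasurable]
  refine lintegral_congr fun r => ?_
  simp_rw [div_eq_mul_inv]
  exact lintegral_mul_const _ ((measurable_measure_pQt_right μ r).pow_const p)

end RieszEnergy

theorem exists_lintegral_riesz_rpow_le_wolff {N : ℕ} (hN : 2 ≤ N) {p : ℝ} (hp : 0 < p)
    (hp1 : p ≤ 1) (hNp : N * p = 2) (R : ℝ) :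
    ∃ K : ℝ≥0∞, K ≠ ⊤ ∧ ∀ (μ : Measure (PSpace N)) [SFinite μ],
      ∫⁻ z, riesz N R μ z ^ (p + 1) ≤
        K * ∫⁻ z, (∫⁻ r in Ioo (0 : ℝ) R, μ (pQt N r z) ^ p / ENNReal.ofReal r) ∂μ := by
  obtain ⟨K, hK, h⟩ := exists_lintegral_measure_pQt_two_mul_le hN hp.le
  refine ⟨2 ^ (p + 1) * pUnitVol N * K, ENNReal.mul_ne_top (ENNReal.mul_ne_top
    (ENNReal.rpow_ne_top_of_nonneg (by positivity) (by simp)) (pUnitVol_ne_top N)) hK,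
    fun μ _ => (lintegral_riesz_rpow_le μ hN hp hp1 hNp R).trans ?_⟩
  rw [mul_assoc _ K, lintegral_wolff_swap, ← lintegral_const_mul' _ _ hK]
  refine mul_le_mul' le_rfl (setLIntegral_mono' measurableSet_Ioo fun r hr => ?_)
  rw [← mul_div_assoc]
  exact ENNReal.div_le_div_right (h μ r hr.1) _

theorem exists_wolff_le_lintegral_riesz_rpow {N : ℕ} (hN : 2 ≤ N) {p : ℝ} (hp : 0 ≤ p)
    (hNp : N * p = 2) (R : ℝ) :
    ∃ K : ℝ≥0∞, K ≠ ⊤ ∧ ∀ (μ : Measure (PSpace N)) [SFinite μ],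
      ∫⁻ z, (∫⁻ r in Ioo (0 : ℝ) R, μ (pQt N r z) ^ p / ENNReal.ofReal r) ∂μ ≤
        K * ∫⁻ z, riesz N R μ z ^ (p + 1) := by
  obtain ⟨K, hK, h⟩ := exists_volume_mul_lintegral_le_half hN hp
  have hK' : (pUnitVol N)⁻¹ * K ≠ ⊤ :=
    ENNReal.mul_ne_top (ENNReal.inv_ne_top.2 (pUnitVol_ne_zero N)) hK
  refine ⟨(pUnitVol N)⁻¹ * K * 2 ^ p, ENNReal.mul_ne_top hK'
    (ENNReal.rpow_ne_top_of_nonneg hp (by simp)), fun μ _ => ?_⟩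
  calc _ = ∫⁻ r in Ioo (0 : ℝ) R, (∫⁻ w, μ (pQt N r w) ^ p ∂μ) / ENNReal.ofReal r :=
        lintegral_wolff_swap μ R
    _ ≤ ∫⁻ r in Ioo (0 : ℝ) R, (pUnitVol N)⁻¹ * K *
          ((∫⁻ z, μ (pQt N (r / 2) z) ^ (p + 1)) / ENNReal.ofReal (r ^ (N + 3))) := by
        refine setLIntegral_mono' measurableSet_Ioo fun r hr => ?_
        have hr0 : ENNReal.ofReal (r ^ (N + 2)) ≠ 0 := by
          rw [Ne, ENNReal.ofReal_eq_zero, not_le]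
          exact pow_pos hr.1 _
        calc (∫⁻ w, μ (pQt N r w) ^ p ∂μ) / ENNReal.ofReal r
            = (pUnitVol N)⁻¹ * (ENNReal.ofReal (r ^ (N + 3)))⁻¹ *
                (ENNReal.ofReal (r ^ (N + 2)) * pUnitVol N * ∫⁻ w, μ (pQt N r w) ^ p ∂μ) := by
              rw [show N + 3 = (N + 2) + 1 by ring, pow_succ r (N + 2),
                ENNReal.ofReal_mul (pow_nonneg hr.1.le _),
                ENNReal.mul_inv (Or.inl hr0) (Or.inl ENNReal.ofReal_ne_top), div_eq_mul_inv]
              calc _ = 1 * 1 * ((∫⁻ w, μ (pQt N r w) ^ p ∂μ) * (ENNReal.ofReal r)⁻¹) := by ring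
                _ = ((pUnitVol N)⁻¹ * pUnitVol N) *
                    ((ENNReal.ofReal (r ^ (N + 2)))⁻¹ * ENNReal.ofReal (r ^ (N + 2))) *
                    ((∫⁻ w, μ (pQt N r w) ^ p ∂μ) * (ENNReal.ofReal r)⁻¹) := by
                  rw [ENNReal.inv_mul_cancel (pUnitVol_ne_zero N) (pUnitVol_ne_top N),
                    ENNReal.inv_mul_cancel hr0 ENNReal.ofReal_ne_top]
                _ = _ := by ring
          _ ≤ (pUnitVol N)⁻¹ * (ENNReal.ofReal (r ^ (N + 3)))⁻¹ *
                (K * ∫⁻ z, μ (pQt N (r / 2) z) ^ (p + 1)) := mul_le_mul' le_rfl (h μ r hr.1)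
          _ = _ := by
              rw [div_eq_mul_inv (lintegral _ _)]
              ring
    _ ≤ _ := by
        rw [lintegral_const_mul' _ _ hK', mul_assoc _ (2 ^ p)]
        exact mul_le_mul' le_rfl (lintegral_measure_pQt_half_rpow_le μ hp hNp R)

/-- Estimate (5.1): for every nonnegative bounded Radon measure `μ` on `ℝ^{N+1}`,
`∫ (I_2^1[μ])^{(N+2)/N} dxdt ≍ ∫∫_0^1 μ(Q̃_r(x,t))^{2/N} (dr/r) dμ(x,t)`. -/
theorem riesz_energy_wolff_comparison (N : ℕ) (hN : 2 ≤ N) :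
    ∃ C : ℝ, 1 ≤ C ∧ ∀ μ : Measure (PSpace N), IsFiniteMeasure μ →
      ENNReal.ofReal C⁻¹ *
          (∫⁻ z, (∫⁻ r in Ioo (0 : ℝ) 1, μ (pQt N r z) ^ ((2 : ℝ) / N) / ENNReal.ofReal r) ∂μ)
        ≤ (∫⁻ z, riesz N 1 μ z ^ (((N : ℝ) + 2) / N)) ∧
      (∫⁻ z, riesz N 1 μ z ^ (((N : ℝ) + 2) / N)) ≤
        ENNReal.ofReal C *
          (∫⁻ z, (∫⁻ r in Ioo (0 : ℝ) 1, μ (pQt N r z) ^ ((2 : ℝ) / N) / ENNReal.ofReal r) ∂μ) := by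
  have hN0 : (2 : ℝ) ≤ N := by exact_mod_cast hN
  have hp : (0 : ℝ) < 2 / N := by positivity
  have hp1 : (2 : ℝ) / N ≤ 1 := (div_le_one (by linarith)).2 hN0
  have hNp : (N : ℝ) * (2 / N) = 2 := mul_div_cancel₀ _ (by linarith)
  have hexp : ((N : ℝ) + 2) / N = 2 / N + 1 := by
    rw [add_div, div_self (by linarith), add_comm]
  obtain ⟨K₁, hK₁, h₁⟩ := exists_wolff_le_lintegral_riesz_rpow hN hp.le hNp 1
  obtain ⟨K₂, hK₂, h₂⟩ := exists_lintegral_riesz_rpow_le_wolff hN hp hp1 hNp 1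
  have hC : 1 ≤ max 1 (max K₁.toReal K₂.toReal) := le_max_left _ _
  refine ⟨max 1 (max K₁.toReal K₂.toReal), hC, fun μ _ => ?_⟩
  rw [hexp]
  constructor
  · rw [ENNReal.ofReal_inv_of_pos (by linarith), mul_comm, ← div_eq_mul_inv]
    refine ENNReal.div_le_of_le_mul' ((h₁ μ).trans (mul_le_mul' ?_ le_rfl))
    exact (ENNReal.le_ofReal_iff_toReal_le hK₁ (by linarith)).2
      ((le_max_left _ _).trans (le_max_right _ _))
  · refine (h₂ μ).trans (mul_le_mul' ?_ le_rfl)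
    exact (ENNReal.le_ofReal_iff_toReal_le hK₂ (by linarith)).2
      ((le_max_right _ _).trans (le_max_right _ _))
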